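/- arXiv:2401.11127 — 6 statements merged into one kernel-verified Lean document; each statement's English description precedes it below -/
import Mathlib

section
/- Let L be an invertible n_L×n_L real matrix, R an invertible n_R×n_R real matrix, p, q ∈ ℕ, and let i_L : Fin p → Fin n_L, i_R : Fin p → Fin n_R, j_L : Fin q → Fin n_L, j_R : Fin q → Fin n_R be injective maps. Let N be the block matrix with row blocks of sizes (n_L, n_R, p, q) and column blocks of sizes (n_L, n_R, q, p) given by N = [[L, 0, E_{j_L}, 0],[0, R, E_{j_R}, 0],[E_{i_L}ᵀ, E_{i_R}ᵀ, 0, I_p],[0, 0, I_q, 0]], and let N'' be the block matrix with row blocks of sizes (n_L, n_R, q, p) and column blocks of sizes (n_L, n_R, p, q) given by N'' = [[L⁻¹, 0, 0, −L⁻¹E_{j_L}],[0, R⁻¹, 0, −R⁻¹E_{j_R}],[0, 0, 0, I_q],[−E_{i_L}ᵀL⁻¹, −E_{i_R}ᵀR⁻¹, I_p, E_{i_L}ᵀL⁻¹E_{j_L} + E_{i_R}ᵀR⁻¹E_{j_R}]]. Then N · N'' = I and N'' · N = I, i.e., N'' is a two-sided inverse of N. In particular, the (4,4) block of the inverse of N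 is (L⁻¹)_{i_L,j_L} + (R⁻¹)_{i_R,j_R}. -/
open Matrix

/-- For an injective map `j : Fin m → Fin n`, the column-selection matrix
`E_j ∈ ℝ^{n×m}` with `(E_j)_{a,b} = 1` if `a = j b` and `0` otherwise. -/
def sel {m n : ℕ} (j : Fin m → Fin n) : Matrix (Fin n) (Fin m) ℝ :=
  fun a b => if a = j b then 1 else 0

/-- **Addition gate.** With row blocks `(n_L, n_R, p, q)` and column blocks
`(n_L, n_R, q, p)`, the matrix
`N = [[L, 0, E_{j_L}, 0], [0, R, E_{j_R}, 0], [E_{i_L}ᵀ, E_{i_R}ᵀ, 0, I_p], [0, 0, I_q, 0]]`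
has the two-sided inverse
`N'' = [[L⁻¹, 0, 0, −L⁻¹E_{j_L}], [0, R⁻¹, 0, −R⁻¹E_{j_R}], [0, 0, 0, I_q],
[−E_{i_L}ᵀL⁻¹, −E_{i_R}ᵀR⁻¹, I_p, E_{i_L}ᵀL⁻¹E_{j_L} + E_{i_R}ᵀR⁻¹E_{j_R}]]`. -/
theorem addition_gate_inverse
    (nL nR p q : ℕ)
    (L : Matrix (Fin nL) (Fin nL) ℝ) (R : Matrix (Fin nR) (Fin nR) ℝ)
    (hL : IsUnit L.det) (hR : IsUnit R.det)
    (iL : Fin p → Fin nL) (iR : Fin p → Fin nR)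
    (jL : Fin q → Fin nL) (jR : Fin q → Fin nR)
    (hiL : Function.Injective iL) (hiR : Function.Injective iR)
    (hjL : Function.Injective jL) (hjR : Function.Injective jR)
    (N : Matrix ((Fin nL ⊕ Fin nR) ⊕ (Fin p ⊕ Fin q))
                ((Fin nL ⊕ Fin nR) ⊕ (Fin q ⊕ Fin p)) ℝ)
    (hN : N = Matrix.fromBlocks
        (Matrix.fromBlocks L 0 0 R)
        (Matrix.fromBlocks (sel jL) 0 (sel jR) 0)
        (Matrix.fromBlocks (sel iL)ᵀ (sel iR)ᵀ 0 0)
        (Matrix.fromBlocks 0 1 1 0))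
    (N'' : Matrix ((Fin nL ⊕ Fin nR) ⊕ (Fin q ⊕ Fin p))
                  ((Fin nL ⊕ Fin nR) ⊕ (Fin p ⊕ Fin q)) ℝ)
    (hN'' : N'' = Matrix.fromBlocks
        (Matrix.fromBlocks L⁻¹ 0 0 R⁻¹)
        (Matrix.fromBlocks 0 (-(L⁻¹ * sel jL)) 0 (-(R⁻¹ * sel jR)))
        (Matrix.fromBlocks 0 0 (-((sel iL)ᵀ * L⁻¹)) (-((sel iR)ᵀ * R⁻¹)))
        (Matrix.fromBlocks 0 1 1
          ((sel iL)ᵀ * L⁻¹ * sel jL + (sel iR)ᵀ * R⁻¹ * sel jR))) :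
    N * N'' = 1 ∧ N'' * N = 1 := by
  subst hN hN''
  have h_cancel : -((sel iL)ᵀ * (L⁻¹ * sel jL)) + -((sel iR)ᵀ * (R⁻¹ * sel jR)) +
      ((sel iL)ᵀ * (L⁻¹ * sel jL) + (sel iR)ᵀ * (R⁻¹ * sel jR)) = 0 := by abel
  constructor <;>
    simp [Matrix.fromBlocks_multiply, Matrix.fromBlocks_add, Matrix.mul_nonsing_inv _ hL,
      Matrix.mul_nonsing_inv _ hR, Matrix.nonsing_inv_mul _ hL, Matrix.nonsing_inv_mul _ hR,
      Matrix.mul_assoc, Matrix.mul_nonsing_inv_cancel_left _ _ hL,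
      Matrix.mul_nonsing_inv_cancel_left _ _ hR, h_cancel]
end

section
/- Let L be an invertible n_L×n_L real matrix, R an invertible n_R×n_R real matrix, p, q ∈ ℕ, and let i_L : Fin p → Fin n_L, i_R : Fin p → Fin n_R, j_L : Fin q → Fin n_L, j_R : Fin q → Fin n_R be injective maps. Let N be the square matrix of size n_L+n_R+p+q obtained by concatenating (in order) the block structure with row blocks of sizes (n_L, n_R, p, q) and column blocks of sizes (n_L, n_R, q, p), whose blocks are N = [[L, 0, E_{j_L}, 0],[0, R, E_{j_R}, 0],[E_{i_L}ᵀ, E_{i_R}ᵀ, 0, I_p],[0, 0, I_q, 0]]. Then |det(N)| = |det(L)| · |det(R)|. -/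
open Matrix

/-- Equivalence concatenating the four row blocks `(a, b, c, d)` in order. -/
def blockEquiv (a b c d : ℕ) : ((Fin a ⊕ Fin b) ⊕ (Fin c ⊕ Fin d)) ≃ Fin (a + b + c + d) :=
  ((finSumFinEquiv.sumCongr finSumFinEquiv).trans finSumFinEquiv).trans
    (finCongr (by omega))

/-- The determinant of `[[A, B, 0], [C, 0, 1], [0, 1, 0]]` is, up to sign, that of `A`,
however the rows and columns are enumerated. -/
theorem abs_det_submatrix_fromBlocks_swap {m p q k : Type*} [Fintype m] [DecidableEq m]
    [Fintype p] [DecidableEq p] [Fintype q] [DecidableEq q] [Fintype k] [DecidableEq k]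
    (A : Matrix m m ℝ) (B : Matrix m q ℝ) (C : Matrix p m ℝ)
    (e : k ≃ m ⊕ (p ⊕ q)) (f : k ≃ m ⊕ (q ⊕ p)) :
    |((fromBlocks A (fromCols B 0) (fromRows C 0) (fromBlocks 0 1 1 0)).submatrix e f).det| =
      |A.det| := by
  let s : m ⊕ (q ⊕ p) ≃ m ⊕ (p ⊕ q) := (Equiv.refl m).sumCongr (Equiv.sumComm q p)
  have h : (fromBlocks A (fromCols B 0) (fromRows C 0) (fromBlocks 0 1 1 0)).submatrix e f =
      (fromBlocks A (fromCols 0 B) (fromRows C 0) 1).submatrix e (f.trans s) := by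
    ext x y
    rcases hx : e x with a | a | a <;> rcases hy : f y with b | b | b <;>
      simp [s, hx, hy, one_apply]
  rw [h, abs_det_submatrix_equiv_equiv, det_fromBlocks_one₂₂, fromCols_mul_fromRows]
  simp

/-- **Determinant of the addition-gate matrix.** Viewing the block matrix
`N = [[L, 0, E_{j_L}, 0], [0, R, E_{j_R}, 0], [E_{i_L}ᵀ, E_{i_R}ᵀ, 0, I_p], [0, 0, I_q, 0]]`
(with row blocks of sizes `(n_L, n_R, p, q)` and column blocks of sizes `(n_L, n_R, q, p)`)
as an ordinary square matrix of size `n_L + n_R + p + q`, one has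
`|det N| = |det L| * |det R|`. -/
theorem abs_det_addition_gate
    (nL nR p q : ℕ)
    (L : Matrix (Fin nL) (Fin nL) ℝ) (R : Matrix (Fin nR) (Fin nR) ℝ)
    (hL : IsUnit L.det) (hR : IsUnit R.det)
    (iL : Fin p → Fin nL) (iR : Fin p → Fin nR)
    (jL : Fin q → Fin nL) (jR : Fin q → Fin nR)
    (hiL : Function.Injective iL) (hiR : Function.Injective iR)
    (hjL : Function.Injective jL) (hjR : Function.Injective jR)
    (N : Matrix (Fin (nL + nR + p + q)) (Fin (nL + nR + p + q)) ℝ)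
    (hN : N = (Matrix.fromBlocks
        (Matrix.fromBlocks L 0 0 R)
        (Matrix.fromBlocks (sel jL) 0 (sel jR) 0)
        (Matrix.fromBlocks (sel iL)ᵀ (sel iR)ᵀ 0 0)
        (Matrix.fromBlocks 0 1 1 0)).submatrix
          (blockEquiv nL nR p q).symm
          ((blockEquiv nL nR q p).trans (finCongr (by omega : nL + nR + q + p = nL + nR + p + q))).symm) :
    |N.det| = |L.det| * |R.det| := by
  have hB : fromBlocks (sel jL) (0 : Matrix _ (Fin p) ℝ) (sel jR) 0 =
      fromCols (fromRows (sel jL) (sel jR)) 0 := by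
    ext (a | a) (b | b) <;> rfl
  have hC : fromBlocks (sel iL)ᵀ (sel iR)ᵀ (0 : Matrix (Fin q) _ ℝ) 0 =
      fromRows (fromCols (sel iL)ᵀ (sel iR)ᵀ) 0 := by
    ext (a | a) (b | b) <;> rfl
  rw [hN, hB, hC, abs_det_submatrix_fromBlocks_swap, det_fromBlocks_zero₂₁, abs_mul]
end

section
/- Let N' be an invertible n×n real matrix, let i, j : Fin m → Fin n be injective maps, and suppose the m×m matrix B := E_iᵀ N'⁻¹ E_j is invertible. Let N be the (n+m)×(n+m) block matrix N = [[N', −E_j],[E_iᵀ, 0]]. Then N is invertible and N⁻¹ = [[N'⁻¹ − N'⁻¹E_j B⁻¹ E_iᵀ N'⁻¹, N'⁻¹E_j B⁻¹],[−B⁻¹ E_iᵀ N'⁻¹, B⁻¹]]. In particular, the bottom-right m×m block of N⁻¹ is the inverse of the submatrix (N'⁻¹)_{i,j}. -/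
open Matrix

theorem fromBlocks_neg_zero_mul_eq_one {l k R : Type*} [Fintype l] [DecidableEq l] [Fintype k]
    [DecidableEq k] [CommRing R] {A : Matrix l l R} (U : Matrix l k R) (V : Matrix k l R)
    (hA : IsUnit A.det) (hS : IsUnit (V * A⁻¹ * U).det) :
    fromBlocks A (-U) V 0 *
      fromBlocks (A⁻¹ - A⁻¹ * U * (V * A⁻¹ * U)⁻¹ * V * A⁻¹) (A⁻¹ * U * (V * A⁻¹ * U)⁻¹)
        (-((V * A⁻¹ * U)⁻¹ * V * A⁻¹)) (V * A⁻¹ * U)⁻¹ = 1 := by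
  have hSS := mul_nonsing_inv _ hS
  generalize hT : (V * A⁻¹ * U)⁻¹ = T at hSS ⊢
  have hVT : V * (A⁻¹ * (U * T)) = 1 := by simpa only [Matrix.mul_assoc] using hSS
  have hVTX (X : Matrix k l R) : V * (A⁻¹ * (U * (T * X))) = X := by
    simpa only [Matrix.mul_assoc, Matrix.one_mul] using congrArg (· * X) hVT
  rw [fromBlocks_multiply, ← fromBlocks_one]
  congr 1 <;>
    simp [Matrix.mul_sub, Matrix.mul_assoc, mul_nonsing_inv_cancel_left _ _ hA,
      mul_nonsing_inv _ hA, hVT, hVTX]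

/-- **Inversion gate.** Let `N'` be invertible, `i j : Fin m → Fin n` injective, and
suppose `B := E_iᵀ N'⁻¹ E_j` is invertible. Then the block matrix
`N = [[N', −E_j], [E_iᵀ, 0]]` is invertible with
`N⁻¹ = [[N'⁻¹ − N'⁻¹E_j B⁻¹ E_iᵀ N'⁻¹, N'⁻¹E_j B⁻¹], [−B⁻¹ E_iᵀ N'⁻¹, B⁻¹]]`;
in particular the bottom-right block of `N⁻¹` is the inverse of `(N'⁻¹)_{i,j}`. -/
theorem inversion_gate_inverse
    (n m : ℕ) (N' : Matrix (Fin n) (Fin n) ℝ) (hN' : IsUnit N'.det)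
    (i j : Fin m → Fin n) (hi : Function.Injective i) (hj : Function.Injective j)
    (B : Matrix (Fin m) (Fin m) ℝ) (hB : B = (sel i)ᵀ * N'⁻¹ * sel j)
    (hBunit : IsUnit B.det)
    (N : Matrix (Fin n ⊕ Fin m) (Fin n ⊕ Fin m) ℝ)
    (hN : N = Matrix.fromBlocks N' (-(sel j)) (sel i)ᵀ 0) :
    IsUnit N.det ∧
    N⁻¹ = Matrix.fromBlocks
      (N'⁻¹ - N'⁻¹ * sel j * B⁻¹ * (sel i)ᵀ * N'⁻¹)
      (N'⁻¹ * sel j * B⁻¹)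
      (-(B⁻¹ * (sel i)ᵀ * N'⁻¹))
      B⁻¹ := by
  subst hB hN
  have h := fromBlocks_neg_zero_mul_eq_one (sel j) (sel i)ᵀ hN' hBunit
  exact ⟨isUnit_det_of_right_inverse h, inv_eq_right_inv h⟩
end

section
/- Let L be an invertible n_L×n_L real matrix, R an invertible n_R×n_R real matrix, m ∈ ℕ, and let j_L : Fin m → Fin n_L and i_R : Fin m → Fin n_R be injective maps. Let N be the (n_L+n_R)×(n_L+n_R) block matrix N = [[L, −E_{j_L} E_{i_R}ᵀ],[0, R]]. Then N is invertible and N⁻¹ = [[L⁻¹, (L⁻¹E_{j_L})(E_{i_R}ᵀR⁻¹)],[0, R⁻¹]]. Consequently, for any p, q ∈ ℕ and injective maps i_L : Fin p → Fin n_L and j_R : Fin q → Fin n_R, the p×q submatrix of N⁻¹ with rows indexed by i_L within the first row block and columns indexed by j_R within the second column block equals (L⁻¹)_{i_L,j_L} · (R⁻¹)_{i_R,j_R}. -/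
open Matrix

theorem mul_sel {k m n : ℕ} (A : Matrix (Fin k) (Fin n) ℝ) (j : Fin m → Fin n) :
    A * sel j = A.submatrix id j := by
  ext a b
  simp [Matrix.mul_apply, sel]

theorem sel_transpose_mul {k m n : ℕ} (A : Matrix (Fin n) (Fin k) ℝ) (i : Fin m → Fin n) :
    (sel i)ᵀ * A = A.submatrix i id := by
  ext a b
  simp [Matrix.mul_apply, sel]

/-- **Multiplication gate.** Let `L`, `R` be invertible and `j_L : Fin m → Fin n_L`,
`i_R : Fin m → Fin n_R` injective. Then `N = [[L, −E_{j_L}E_{i_R}ᵀ], [0, R]]` is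
invertible with `N⁻¹ = [[L⁻¹, (L⁻¹E_{j_L})(E_{i_R}ᵀR⁻¹)], [0, R⁻¹]]`, and for all
injective `i_L : Fin p → Fin n_L`, `j_R : Fin q → Fin n_R` the corresponding
submatrix of `N⁻¹` equals `(L⁻¹)_{i_L,j_L} * (R⁻¹)_{i_R,j_R}`. -/
theorem multiplication_gate_inverse
    (nL nR m : ℕ)
    (L : Matrix (Fin nL) (Fin nL) ℝ) (R : Matrix (Fin nR) (Fin nR) ℝ)
    (hL : IsUnit L.det) (hR : IsUnit R.det)
    (jL : Fin m → Fin nL) (iR : Fin m → Fin nR)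
    (hjL : Function.Injective jL) (hiR : Function.Injective iR)
    (N : Matrix (Fin nL ⊕ Fin nR) (Fin nL ⊕ Fin nR) ℝ)
    (hN : N = Matrix.fromBlocks L (-(sel jL * (sel iR)ᵀ)) 0 R) :
    IsUnit N.det ∧
    N⁻¹ = Matrix.fromBlocks L⁻¹ ((L⁻¹ * sel jL) * ((sel iR)ᵀ * R⁻¹)) 0 R⁻¹ ∧
    ∀ (p q : ℕ) (iL : Fin p → Fin nL) (jR : Fin q → Fin nR),
      Function.Injective iL → Function.Injective jR →
      (N⁻¹).submatrix (fun a => Sum.inl (iL a)) (fun b => Sum.inr (jR b))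
        = (L⁻¹.submatrix iL jL) * (R⁻¹.submatrix iR jR) := by
  have hL' : IsUnit L := (Matrix.isUnit_iff_isUnit_det L).2 hL
  have hR' : IsUnit R := (Matrix.isUnit_iff_isUnit_det R).2 hR
  have h_inv : N⁻¹ =
      Matrix.fromBlocks L⁻¹ ((L⁻¹ * sel jL) * ((sel iR)ᵀ * R⁻¹)) 0 R⁻¹ := by
    rw [hN, Matrix.inv_fromBlocks_zero₂₁_of_isUnit_iff _ _ _ (iff_of_true hL' hR')]
    simp only [Matrix.mul_neg, Matrix.neg_mul, neg_neg, Matrix.mul_assoc]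
  refine ⟨?_, h_inv, fun p q iL jR _ _ => ?_⟩
  · rw [hN, Matrix.det_fromBlocks_zero₂₁]
    exact hL.mul hR
  · rw [h_inv, mul_sel, sel_transpose_mul]
    ext a b
    simp [Matrix.mul_apply]
end

section
/- Let N' be an invertible n×n real matrix, let i, j : Fin m → Fin n be injective maps, and suppose B := E_iᵀ N'⁻¹ E_j is invertible. Let N be the (n+m)×(n+m) block matrix N = [[N', −E_j],[E_iᵀ, 0]]. Then ‖N‖_F ≤ ‖N'‖_F + √(2m), and ‖N⁻¹‖_F ≤ ‖N'⁻¹‖_F + ‖B⁻¹‖_F · (‖E_iᵀN'⁻¹‖_F + 1) · (‖N'⁻¹E_j‖_F + 1). -/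
open Matrix

/-- The Frobenius norm of a real matrix: the square root of the sum of the
squares of its entries. -/
noncomputable def frob {α β : Type*} [Fintype α] [Fintype β]
    (A : Matrix α β ℝ) : ℝ :=
  Real.sqrt (∑ a, ∑ b, (A a b) ^ 2)

section Frobenius

variable {α β γ δ : Type*} [Fintype α] [Fintype β] [Fintype γ] [Fintype δ]

attribute [local instance] Matrix.frobeniusNormedAddCommGroup

lemma frob_eq_norm (A : Matrix α β ℝ) : frob A = ‖A‖ := by
  simp [frob, Matrix.frobenius_norm_def, Real.sqrt_eq_rpow]

lemma frob_nonneg (A : Matrix α β ℝ) : 0 ≤ frob A := Real.sqrt_nonneg _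

lemma frob_sub_le (A B : Matrix α β ℝ) : frob (A - B) ≤ frob A + frob B := by
  simpa only [frob_eq_norm] using norm_sub_le A B

lemma frob_neg (A : Matrix α β ℝ) : frob (-A) = frob A := by
  simp only [frob_eq_norm, norm_neg]

lemma frob_mul_le (A : Matrix α β ℝ) (B : Matrix β γ ℝ) : frob (A * B) ≤ frob A * frob B := by
  simpa only [frob_eq_norm] using Matrix.frobenius_norm_mul A B

lemma frob_sq (A : Matrix α β ℝ) : frob A ^ 2 = ∑ a, ∑ b, A a b ^ 2 :=
  Real.sq_sqrt (Finset.sum_nonneg fun _ _ => Finset.sum_nonneg fun _ _ => sq_nonneg _)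

lemma frob_fromBlocks_sq (A : Matrix α γ ℝ) (B : Matrix α δ ℝ) (C : Matrix β γ ℝ)
    (D : Matrix β δ ℝ) :
    frob (fromBlocks A B C D) ^ 2 = frob A ^ 2 + frob B ^ 2 + frob C ^ 2 + frob D ^ 2 := by
  simp only [frob_sq, Fintype.sum_sum_type, fromBlocks_apply₁₁, fromBlocks_apply₁₂,
    fromBlocks_apply₂₁, fromBlocks_apply₂₂, Finset.sum_add_distrib]
  ring

lemma frob_fromBlocks_le (A : Matrix α γ ℝ) (B : Matrix α δ ℝ) (C : Matrix β γ ℝ)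
    (D : Matrix β δ ℝ) :
    frob (fromBlocks A B C D) ≤ frob A + frob B + frob C + frob D := by
  have hA := frob_nonneg A
  have hB := frob_nonneg B
  have hC := frob_nonneg C
  have hD := frob_nonneg D
  refine le_of_sq_le_sq ?_ (by positivity)
  rw [frob_fromBlocks_sq]
  nlinarith [mul_nonneg hA hB, mul_nonneg hA hC, mul_nonneg hA hD, mul_nonneg hB hC,
    mul_nonneg hB hD, mul_nonneg hC hD]

lemma frob_zero : frob (0 : Matrix α β ℝ) = 0 := by simp [frob]

lemma frob_transpose_sq (A : Matrix α β ℝ) : frob Aᵀ ^ 2 = frob A ^ 2 := by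
  simp only [frob_eq_norm, Matrix.frobenius_norm_transpose]

end Frobenius

lemma frob_sel_sq {m n : ℕ} (j : Fin m → Fin n) : frob (sel j) ^ 2 = m := by
  rw [frob_sq, Finset.sum_comm]
  simp [sel]

/-- The inverse of a block matrix `[[A, -F], [G, 0]]` whose Schur complement `G A⁻¹ F`
is invertible. -/
lemma inv_fromBlocks_neg_zero {α β R : Type*} [Fintype α] [DecidableEq α] [Fintype β]
    [DecidableEq β] [CommRing R] (A : Matrix α α R) (F : Matrix α β R) (G : Matrix β α R)
    (hA : IsUnit A.det) (hS : IsUnit (G * A⁻¹ * F).det) :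
    (fromBlocks A (-F) G 0)⁻¹ =
      fromBlocks (A⁻¹ - A⁻¹ * F * (G * A⁻¹ * F)⁻¹ * (G * A⁻¹)) (A⁻¹ * F * (G * A⁻¹ * F)⁻¹)
        (-((G * A⁻¹ * F)⁻¹ * (G * A⁻¹))) (G * A⁻¹ * F)⁻¹ := by
  apply Matrix.inv_eq_right_inv
  have hS' := Matrix.mul_nonsing_inv _ hS
  set S := (G * A⁻¹ * F)⁻¹
  have hS'' : G * (A⁻¹ * (F * S)) = 1 := by simpa only [Matrix.mul_assoc] using hS'
  have hGS (X : Matrix β α R) : G * (A⁻¹ * (F * (S * X))) = X := by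
    simpa only [Matrix.mul_assoc, Matrix.one_mul] using congrArg (· * X) hS''
  rw [fromBlocks_multiply, ← fromBlocks_one]
  congr 1 <;>
    simp [Matrix.mul_sub, Matrix.mul_assoc, Matrix.mul_nonsing_inv_cancel_left _ _ hA,
      Matrix.mul_nonsing_inv _ hA, hGS, hS'']

/-- **Frobenius-norm bounds for the inversion gate.** With
`N = [[N', −E_j], [E_iᵀ, 0]]` and `B := E_iᵀ N'⁻¹ E_j` invertible, one has
`‖N‖_F ≤ ‖N'‖_F + √(2m)` and
`‖N⁻¹‖_F ≤ ‖N'⁻¹‖_F + ‖B⁻¹‖_F (‖E_iᵀN'⁻¹‖_F + 1)(‖N'⁻¹E_j‖_F + 1)`. -/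
theorem inversion_gate_frobenius_bounds
    (n m : ℕ) (N' : Matrix (Fin n) (Fin n) ℝ) (hN' : IsUnit N'.det)
    (i j : Fin m → Fin n) (hi : Function.Injective i) (hj : Function.Injective j)
    (B : Matrix (Fin m) (Fin m) ℝ) (hB : B = (sel i)ᵀ * N'⁻¹ * sel j)
    (hBunit : IsUnit B.det)
    (N : Matrix (Fin n ⊕ Fin m) (Fin n ⊕ Fin m) ℝ)
    (hN : N = Matrix.fromBlocks N' (-(sel j)) (sel i)ᵀ 0) :
    frob N ≤ frob N' + Real.sqrt (2 * m) ∧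
    frob N⁻¹ ≤ frob N'⁻¹ +
      frob B⁻¹ * (frob ((sel i)ᵀ * N'⁻¹) + 1) * (frob (N'⁻¹ * sel j) + 1) := by
  subst hB hN
  constructor
  · refine le_of_sq_le_sq ?_ (add_nonneg (frob_nonneg _) (Real.sqrt_nonneg _))
    rw [frob_fromBlocks_sq, frob_neg, frob_transpose_sq, frob_sel_sq, frob_sel_sq, frob_zero,
      add_sq, Real.sq_sqrt (by positivity)]
    nlinarith [mul_nonneg (frob_nonneg N') (Real.sqrt_nonneg (2 * m))]
  · rw [inv_fromBlocks_neg_zero _ _ _ hN' hBunit]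
    set S := ((sel i)ᵀ * N'⁻¹ * sel j)⁻¹
    set P := (sel i)ᵀ * N'⁻¹
    set Q := N'⁻¹ * sel j
    have hQS := frob_mul_le Q S
    have hQSP := (frob_mul_le (Q * S) P).trans
      (mul_le_mul_of_nonneg_right hQS (frob_nonneg P))
    have hSP := frob_mul_le S P
    have hsub := frob_sub_le N'⁻¹ (Q * S * P)
    have hblocks := frob_fromBlocks_le (N'⁻¹ - Q * S * P) (Q * S) (-(S * P)) S
    rw [frob_neg] at hblocks
    linarith
end

section
/- Let n ≥ 2, let A and X be n×n real matrices with A invertible and A⁻¹X ≠ 0, let 0 ≤ ε ≤ 1, and set ε̂ = ε / (n² · σ_max(A⁻¹X)), where σ_max denotes the largest singular value (equivalently, the ℓ²-operator norm). Then det(A + ε̂X) and det(A) have the same sign (i.e., det(A + ε̂X)·det(A) ≥ 0), and |det(A)| · (1 + ε̂·tr(A⁻¹X) − ε²/n) ≤ |det(A + ε̂X)| ≤ |det(A)| · (1 + ε̂·tr(A⁻¹X) + ε²/n). -/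
open Matrix

/-- The largest singular value of a real square matrix, i.e. its operator norm
with respect to the Euclidean (ℓ²) norm. -/
noncomputable def sigmaMax {n : ℕ} (A : Matrix (Fin n) (Fin n) ℝ) : ℝ :=
  ‖LinearMap.toContinuousLinearMap (Matrix.toEuclideanLin A)‖

theorem sigmaMax_smul {n : ℕ} (c : ℝ) (B : Matrix (Fin n) (Fin n) ℝ) :
    sigmaMax (c • B) = |c| * sigmaMax B := by
  simp [sigmaMax, norm_smul]

theorem sigmaMax_pos {n : ℕ} {B : Matrix (Fin n) (Fin n) ℝ} (hB : B ≠ 0) : 0 < sigmaMax B := by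
  simpa [sigmaMax] using hB

theorem sum_mulVec_sq_le {n : ℕ} (B : Matrix (Fin n) (Fin n) ℝ) (a : Fin n → ℝ) :
    ∑ i, (B *ᵥ a) i ^ 2 ≤ sigmaMax B ^ 2 * ∑ i, a i ^ 2 := by
  have h := (LinearMap.toContinuousLinearMap (Matrix.toEuclideanLin B)).le_opNorm (WithLp.toLp 2 a)
  have h2 := pow_le_pow_left₀ (norm_nonneg _) h 2
  rw [mul_pow, EuclideanSpace.norm_sq_eq, EuclideanSpace.norm_sq_eq] at h2
  simpa [sigmaMax, Matrix.toLpLin_apply] using h2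

/-- Every complex eigenvalue of a real matrix is bounded by its largest singular value. -/
theorem norm_le_sigmaMax_of_mem_roots_charpoly {n : ℕ} (B : Matrix (Fin n) (Fin n) ℝ) {z : ℂ}
    (hz : z ∈ (B.map Complex.ofReal).charpoly.roots) : ‖z‖ ≤ sigmaMax B := by
  have hroot := (Polynomial.mem_roots'.mp hz).2
  rw [Polynomial.IsRoot, Matrix.eval_charpoly] at hroot
  obtain ⟨v, hv, hker⟩ := Matrix.exists_mulVec_eq_zero_iff.mpr hroot
  have hmul : ∀ i, (B.map Complex.ofReal *ᵥ v) i = z * v i := by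
    intro i
    have hi := congrFun hker i
    rw [Matrix.sub_mulVec] at hi
    simpa [Matrix.scalar_apply, Matrix.mulVec_diagonal, sub_eq_zero, eq_comm] using hi
  have hre : ∀ i, (B *ᵥ fun j => (v j).re) i = (z * v i).re := by
    intro i
    simp [← hmul, Matrix.mulVec, dotProduct]
  have him : ∀ i, (B *ᵥ fun j => (v j).im) i = (z * v i).im := by
    intro i
    simp [← hmul, Matrix.mulVec, dotProduct]
  have hsum : ∀ w : Fin n → ℂ, ∑ i, ‖w i‖ ^ 2 = ∑ i, (w i).re ^ 2 + ∑ i, (w i).im ^ 2 := by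
    intro w
    rw [← Finset.sum_add_distrib]
    exact Finset.sum_congr rfl fun i _ => by rw [Complex.sq_norm, Complex.normSq_apply]; ring
  have hle : ‖z‖ ^ 2 * ∑ i, ‖v i‖ ^ 2 ≤ sigmaMax B ^ 2 * ∑ i, ‖v i‖ ^ 2 := by
    calc ‖z‖ ^ 2 * ∑ i, ‖v i‖ ^ 2 = ∑ i, ‖z * v i‖ ^ 2 := by
          simp [Finset.mul_sum, mul_pow]
      _ = ∑ i, (z * v i).re ^ 2 + ∑ i, (z * v i).im ^ 2 := hsum _
      _ ≤ sigmaMax B ^ 2 * ∑ i, ‖v i‖ ^ 2 := by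
          rw [hsum v, mul_add]
          simp only [← hre, ← him]
          exact add_le_add (sum_mulVec_sq_le B _) (sum_mulVec_sq_le B _)
  obtain ⟨i, hi⟩ := Function.ne_iff.mp hv
  have hpos : 0 < ∑ i, ‖v i‖ ^ 2 :=
    Finset.sum_pos' (fun _ _ => by positivity) ⟨i, Finset.mem_univ i, pow_pos (norm_pos_iff.mpr hi) 2⟩
  exact le_of_sq_le_sq (le_of_mul_le_mul_right hle hpos) (norm_nonneg _)

theorem norm_multiset_prod_one_sub_bounds {δ : ℝ} (s : Multiset ℂ) (hs : ∀ z ∈ s, ‖z‖ ≤ δ) :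
    ‖(s.map fun z => 1 - z).prod - 1‖ ≤ (1 + δ) ^ s.card - 1 ∧
    ‖(s.map fun z => 1 - z).prod - 1 + s.sum‖ ≤ (1 + δ) ^ s.card - 1 - s.card * δ := by
  induction s using Multiset.induction_on with
  | empty => simp
  | cons z s ih =>
    obtain ⟨h1, h2⟩ := ih fun w hw => hs w (Multiset.mem_cons_of_mem hw)
    have hz := hs z (Multiset.mem_cons_self z s)
    simp only [Multiset.map_cons, Multiset.prod_cons, Multiset.sum_cons, Multiset.card_cons]
    set P := (s.map fun z => 1 - z).prod
    have hzP : ‖z * (P - 1)‖ ≤ δ * ((1 + δ) ^ s.card - 1) := by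
      rw [norm_mul]
      exact mul_le_mul hz h1 (norm_nonneg _) ((norm_nonneg z).trans hz)
    push_cast
    constructor
    · rw [show (1 - z) * P - 1 = (P - 1) - z - z * (P - 1) by ring, pow_succ]
      linarith [norm_sub_le ((P - 1) - z) (z * (P - 1)), norm_sub_le (P - 1) z]
    · rw [show (1 - z) * P - 1 + (z + s.sum) = (P - 1 + s.sum) - z * (P - 1) by ring, pow_succ]
      linarith [norm_sub_le (P - 1 + s.sum) (z * (P - 1))]

theorem card_roots_charpoly_map_ofReal {n : ℕ} (N : Matrix (Fin n) (Fin n) ℝ) :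
    (N.map Complex.ofReal).charpoly.roots.card = n := by
  rw [← (IsAlgClosed.splits _).natDegree_eq_card_roots, Matrix.charpoly_natDegree_eq_dim,
    Fintype.card_fin]

theorem ofReal_trace_eq_sum_roots_charpoly {n : ℕ} (N : Matrix (Fin n) (Fin n) ℝ) :
    ((N.trace : ℝ) : ℂ) = (N.map Complex.ofReal).charpoly.roots.sum := by
  rw [← Matrix.trace_eq_sum_roots_charpoly]
  simp [Matrix.trace]

theorem ofReal_det_one_sub_eq_prod_roots_charpoly {n : ℕ} (N : Matrix (Fin n) (Fin n) ℝ) :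
    (((1 - N).det : ℝ) : ℂ) =
      ((N.map Complex.ofReal).charpoly.roots.map fun z => 1 - z).prod := by
  rw [← (IsAlgClosed.splits _).eval_eq_prod_roots_of_monic (Matrix.charpoly_monic _),
    Matrix.eval_charpoly, ← Complex.ofRealHom_eq_coe, RingHom.map_det]
  simp only [map_sub, map_one, RingHom.mapMatrix_apply]
  rfl

/-- First-order expansion of the determinant at the identity, with an explicit remainder. -/
theorem abs_det_one_sub_sub_one_add_trace_le {n : ℕ} (N : Matrix (Fin n) (Fin n) ℝ) :
    |(1 - N).det - 1 + N.trace| ≤ (1 + sigmaMax N) ^ n - 1 - n * sigmaMax N := by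
  have h := (norm_multiset_prod_one_sub_bounds _ fun z hz =>
    norm_le_sigmaMax_of_mem_roots_charpoly N hz).2
  rw [← ofReal_det_one_sub_eq_prod_roots_charpoly, ← ofReal_trace_eq_sum_roots_charpoly,
    card_roots_charpoly_map_ofReal] at h
  rw [← Real.norm_eq_abs, ← Complex.norm_real]
  simpa using h

theorem abs_trace_le {n : ℕ} (N : Matrix (Fin n) (Fin n) ℝ) : |N.trace| ≤ n * sigmaMax N := by
  rw [← Real.norm_eq_abs, ← Complex.norm_real, ofReal_trace_eq_sum_roots_charpoly]
  refine (norm_multiset_sum_le _).trans ?_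
  have h := Multiset.sum_le_card_nsmul ((N.map Complex.ofReal).charpoly.roots.map norm)
    (sigmaMax N) fun x hx => by
      obtain ⟨z, hz, rfl⟩ := Multiset.mem_map.mp hx
      exact norm_le_sigmaMax_of_mem_roots_charpoly N hz
  rwa [Multiset.card_map, card_roots_charpoly_map_ofReal, nsmul_eq_mul] at h

/-- **Determinant of a slightly perturbed matrix.** Let `n ≥ 2`, `A` invertible,
`A⁻¹X ≠ 0`, `0 ≤ ε ≤ 1`, and `ε̂ = ε / (n² σ_max(A⁻¹X))`. Then `det (A + ε̂X)` and
`det A` have the same sign, and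
`|det A| (1 + ε̂ tr(A⁻¹X) − ε²/n) ≤ |det (A + ε̂X)| ≤ |det A| (1 + ε̂ tr(A⁻¹X) + ε²/n)`. -/
theorem det_perturbation_bound
    (n : ℕ) (hn : 2 ≤ n) (A X : Matrix (Fin n) (Fin n) ℝ)
    (hA : IsUnit A.det) (hAX : A⁻¹ * X ≠ 0)
    (ε : ℝ) (hε0 : 0 ≤ ε) (hε1 : ε ≤ 1)
    (εhat : ℝ) (hεhat : εhat = ε / ((n : ℝ) ^ 2 * sigmaMax (A⁻¹ * X))) :
    0 ≤ (A + εhat • X).det * A.det ∧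
    |A.det| * (1 + εhat * (A⁻¹ * X).trace - ε ^ 2 / n) ≤ |(A + εhat • X).det| ∧
    |(A + εhat • X).det| ≤ |A.det| * (1 + εhat * (A⁻¹ * X).trace + ε ^ 2 / n) := by
  set B := A⁻¹ * X with hB
  have hσ := sigmaMax_pos hAX
  have hn' : (2 : ℝ) ≤ n := by exact_mod_cast hn
  have hεhat0 : 0 ≤ εhat := by rw [hεhat]; positivity
  have hfactor : (A + εhat • X).det = A.det * (1 - -εhat • B).det := by
    rw [← Matrix.det_mul, mul_sub, mul_one, Matrix.mul_smul, hB,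
      Matrix.mul_nonsing_inv_cancel_left A X hA]
    simp
  have hσN : n * sigmaMax (-εhat • B) = ε / n := by
    rw [sigmaMax_smul, abs_neg, abs_of_nonneg hεhat0, hεhat]
    field_simp
  have hx0 : 0 ≤ ε / n := by positivity
  have hx1 : ε / n ≤ 1 / 2 := by rw [div_le_div_iff₀ (by positivity) (by norm_num)]; linarith
  have hσN0 : 0 ≤ sigmaMax (-εhat • B) := norm_nonneg _
  have hrem : |(1 - -εhat • B).det - 1 + (-εhat • B).trace| ≤ (ε / n) ^ 2 := by
    refine (abs_det_one_sub_sub_one_add_trace_le _).trans ?_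
    have hpow : (1 + sigmaMax (-εhat • B)) ^ n ≤ Real.exp (ε / n) := by
      rw [← hσN, Real.exp_nat_mul]
      gcongr
      linarith [Real.add_one_le_exp (sigmaMax (-εhat • B))]
    have hexp := Real.abs_exp_sub_one_sub_id_le (x := ε / n) (by rw [abs_of_nonneg hx0]; linarith)
    rw [hσN]
    linarith [le_abs_self (Real.exp (ε / n) - 1 - ε / n)]
  have htr := abs_trace_le (-εhat • B)
  rw [hσN] at htr
  rw [Matrix.trace_smul, smul_eq_mul, neg_mul] at hrem htr
  have hsq : (ε / n) ^ 2 ≤ ε ^ 2 / n := by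
    rw [div_pow]
    gcongr
    nlinarith
  rw [hfactor]
  set d := (1 - -εhat • B).det
  obtain ⟨hr1, hr2⟩ := abs_le.mp hrem
  obtain ⟨ht1, ht2⟩ := abs_le.mp htr
  have hd : 0 ≤ d := by nlinarith
  rw [abs_mul, abs_of_nonneg hd]
  refine ⟨?_, ?_, ?_⟩
  · rw [mul_right_comm]
    exact mul_nonneg (mul_self_nonneg _) hd
  · gcongr
    linarith
  · gcongr
    linarith
end
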